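/- Let G = (V, E) be a finite τ-critical simple graph with transversal number τ(G) = t. If |V| + |E| = (t+2 choose 2), then G is isomorphic to a complete graph K_n with n ≥ 2, or to the disjoint union of two edges 2K_2, or to the five-cycle C_5. -/

import Mathlib

open SimpleGraph

/-- A transversal set (vertex cover): a set of vertices meeting every edge. -/
def IsTransversal {V : Type*} (G : SimpleGraph V) (S : Set V) : Prop :=
  ∀ ⦃u v : V⦄, G.Adj u v → u ∈ S ∨ v ∈ S

/-- The transversal number: minimum cardinality of a transversal set. -/
noncomputable def tau {V : Type*} [Fintype V] (G : SimpleGraph V) : ℕ :=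
  sInf {n | ∃ S : Finset V, IsTransversal G ↑S ∧ S.card = n}

/-- A graph with no isolated vertices is τ-critical if deleting any edge
decreases the transversal number by one. -/
def TauCritical {V : Type*} [Fintype V] (G : SimpleGraph V) : Prop :=
  (∀ v : V, ∃ u, G.Adj v u) ∧
  ∀ e ∈ G.edgeSet, tau (G.deleteEdges {e}) = tau G - 1

/-- `2K₂`: the disjoint union of two edges, on vertex set `Fin 4`. -/
def twoK2 : SimpleGraph (Fin 4) := SimpleGraph.fromEdgeSet {s(0, 1), s(2, 3)}

namespace SimpleGraph

section MaximumIndepSet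

variable {V : Type*} [Fintype V] [DecidableEq V] {G : SimpleGraph V} [DecidableRel G.Adj]

/-- An independent set disjoint from a maximum independent set `S` has at least as many neighbours
in `S` as it has elements: otherwise exchanging the two would enlarge `S`. -/
theorem IsMaximumIndepSet.card_le_card_inter_biUnion_neighborFinset {S A : Finset V}
    (hS : G.IsMaximumIndepSet S) (hA : G.IsIndepSet (A : Set V)) (hAS : Disjoint A S) :
    A.card ≤ (S ∩ A.biUnion (G.neighborFinset ·)).card := by
  have hind : G.IsIndepSet ((S \ A.biUnion (G.neighborFinset ·) ∪ A : Finset V) : Set V) := by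
    intro x hx y hy hxy hadj
    simp only [Finset.coe_union, Finset.coe_sdiff, Set.mem_union, Set.mem_sdiff, Finset.mem_coe,
      Finset.mem_biUnion, mem_neighborFinset, not_exists, not_and] at hx hy
    rcases hx with ⟨hx, hxA⟩ | hx <;> rcases hy with ⟨hy, hyA⟩ | hy
    · exact hS.isIndepSet hx hy hxy hadj
    · exact hxA y hy hadj.symm
    · exact hyA x hx hadj
    · exact hA hx hy hxy hadj
  have hle := hS.maximum _ hind
  rw [Finset.card_union_of_disjoint (hAS.symm.mono_left Finset.sdiff_subset)] at hle
  have := Finset.card_sdiff_add_card_inter S (A.biUnion (G.neighborFinset ·))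
  omega

/-- If no vertex lies in every maximum independent set, then Hall's condition holds for independent
sets. -/
theorem card_le_card_biUnion_neighborFinset
    (h : ∀ v, ∃ S : Finset V, G.IsMaximumIndepSet S ∧ v ∉ S) (A : Finset V)
    (hA : G.IsIndepSet (A : Set V)) : A.card ≤ (A.biUnion (G.neighborFinset ·)).card := by
  induction A using Finset.strongInduction with
  | H A ih =>
    rcases A.eq_empty_or_nonempty with rfl | ⟨a, ha⟩
    · simp
    obtain ⟨S, hS, haS⟩ := h a
    have hss : A ∩ S ⊂ A :=
      Finset.ssubset_iff_subset_ne.2 ⟨Finset.inter_subset_left, fun h => haS (by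
        rw [← h] at ha; exact (Finset.mem_inter.1 ha).2)⟩
    have hinter := ih _ hss (hA.mono (by exact_mod_cast hss.1))
    have hdiff := hS.card_le_card_inter_biUnion_neighborFinset (A := A \ S)
      (hA.mono (by simp)) Finset.sdiff_disjoint
    have hdisj : Disjoint ((A ∩ S).biUnion (G.neighborFinset ·))
        (S ∩ (A \ S).biUnion (G.neighborFinset ·)) := by
      rw [Finset.disjoint_left]
      intro x hx hx'
      simp only [Finset.mem_biUnion, Finset.mem_inter, mem_neighborFinset] at hx hx'
      obtain ⟨y, hy, hyx⟩ := hx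
      exact hS.isIndepSet hy.2 hx'.1 hyx.ne hyx
    have hsub : (A ∩ S).biUnion (G.neighborFinset ·) ∪ (S ∩ (A \ S).biUnion (G.neighborFinset ·)) ⊆
        A.biUnion (G.neighborFinset ·) :=
      Finset.union_subset (Finset.biUnion_subset_biUnion_of_subset_left _ hss.1)
        (Finset.inter_subset_right.trans
          (Finset.biUnion_subset_biUnion_of_subset_left _ Finset.sdiff_subset))
    have hcard := Finset.card_le_card hsub
    rw [Finset.card_union_of_disjoint hdisj] at hcard
    have := Finset.card_sdiff_add_card_inter A S
    omega

/-- The union and the intersection of a nonempty family of maximum independent sets have together at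
least twice as many elements as a maximum independent set. -/
theorem two_mul_indepNum_le_card_inf_add_card_sup (F : Finset (Finset V)) (hF : F.Nonempty)
    (h : ∀ S ∈ F, G.IsMaximumIndepSet S) :
    2 * G.indepNum ≤ (F.inf id).card + (F.sup id).card := by
  induction hF using Finset.Nonempty.cons_induction with
  | singleton S =>
    have := maximumIndepSet_card_eq_indepNum S (h S (by simp))
    simp only [Finset.inf_singleton, Finset.sup_singleton, id]
    omega
  | cons S F hSF hF ih =>
    have hS := h S (by simp)
    have hF' : ∀ T ∈ F, G.IsMaximumIndepSet T := fun T hT => h T (by simp [hT])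
    have ih := ih hF'
    rw [Finset.inf_cons, Finset.sup_cons, id, Finset.inf_eq_inter, Finset.sup_eq_union]
    set I := F.inf id with hI
    set U := F.sup id with hU
    have hmemI : ∀ {x}, x ∈ I → ∀ T ∈ F, x ∈ T := fun hx T hT =>
      (Finset.inf_le (f := id) hT : I ≤ T) hx
    have hmemU : ∀ {x}, x ∈ U → ∃ T ∈ F, x ∈ T := fun hx => by
      simpa [hU, Finset.mem_sup] using hx
    obtain ⟨T₀, hT₀⟩ := hF
    have hexch := hS.card_le_card_inter_biUnion_neighborFinset (A := I \ S)
      (by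
        intro x hx y hy
        simp only [Finset.coe_sdiff, Set.mem_sdiff, Finset.mem_coe] at hx hy
        exact (hF' T₀ hT₀).isIndepSet (hmemI hx.1 _ hT₀) (hmemI hy.1 _ hT₀))
      Finset.sdiff_disjoint
    have hsub : S ∩ (I \ S).biUnion (G.neighborFinset ·) ⊆ S \ U := by
      intro x hx
      simp only [Finset.mem_inter, Finset.mem_biUnion, Finset.mem_sdiff,
        mem_neighborFinset] at hx ⊢
      obtain ⟨hxS, y, hy, hyx⟩ := hx
      refine ⟨hxS, fun hxU => ?_⟩
      obtain ⟨T, hT, hxT⟩ := hmemU hxU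
      exact (hF' T hT).isIndepSet (hmemI hy.1 T hT) hxT hyx.ne hyx
    have hle := hexch.trans (Finset.card_le_card hsub)
    have h₁ := Finset.card_sdiff_add_card_inter I S
    have h₂ := Finset.card_sdiff_add_card S U
    rw [Finset.inter_comm I S] at h₁
    omega

/-- **Hajnal's degree bound**: if every edge `vu` admits a maximum independent set that contains `u`
and no other neighbour of `v`, and there are no isolated vertices, then every degree is at most
`n - 2α + 1`. -/
theorem degree_add_two_mul_indepNum_le (hiso : ∀ v, ∃ u, G.Adj v u)
    (hcrit : ∀ v u, G.Adj v u →
      ∃ S : Finset V, G.IsMaximumIndepSet S ∧ u ∈ S ∧ ∀ w ∈ S, G.Adj v w → w = u) (v : V) :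
    G.degree v + 2 * G.indepNum ≤ Fintype.card V + 1 := by
  have hHall := card_le_card_biUnion_neighborFinset (G := G) fun x => by
    obtain ⟨y, hxy⟩ := hiso x
    obtain ⟨S, hS, hy, -⟩ := hcrit x y hxy
    exact ⟨S, hS, fun hx => hS.isIndepSet hx hy hxy.ne hxy⟩
  choose! S hSmax hSmem hSadj using hcrit v
  have hvS : ∀ u, G.Adj v u → v ∉ S u := fun u hu hv =>
    (hSmax u hu).isIndepSet hv (hSmem u hu) hu.ne hu
  let S' : V → Finset V := fun u => insert v ((S u).erase u)
  have hS'max : ∀ u, G.Adj v u → G.IsMaximumIndepSet (S' u) := by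
    intro u hu
    refine ⟨?_, fun T hT => ?_⟩
    · intro x hx y hy hxy hadj
      simp only [S', Finset.coe_insert, Finset.coe_erase, Set.mem_insert_iff, Set.mem_sdiff,
        Finset.mem_coe, Set.mem_singleton_iff] at hx hy
      rcases hx with rfl | hx <;> rcases hy with rfl | hy
      · exact hxy rfl
      · exact hy.2 (hSadj u hu y hy.1 hadj)
      · exact hx.2 (hSadj u hu x hx.1 hadj.symm)
      · exact (hSmax u hu).isIndepSet hx.1 hy.1 hxy hadj
    · have := (hSmax u hu).maximum T hT
      rw [Finset.card_insert_of_notMem (by simp [hvS u hu]), Finset.card_erase_of_mem (hSmem u hu)]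
      omega
  set F := (G.neighborFinset v).image S' with hF
  have hFmax : ∀ T ∈ F, G.IsMaximumIndepSet T := by
    intro T hT
    obtain ⟨u, hu, rfl⟩ := Finset.mem_image.1 hT
    exact hS'max u (by simpa using hu)
  obtain ⟨u₀, hu₀⟩ := hiso v
  have hmemF : ∀ u, G.Adj v u → S' u ∈ F := fun u hu =>
    Finset.mem_image_of_mem _ (by simpa using hu)
  have hfam := two_mul_indepNum_le_card_inf_add_card_sup F ⟨_, hmemF u₀ hu₀⟩ hFmax
  have hmemI : ∀ {x}, x ∈ F.inf id → ∀ u, G.Adj v u → x ∈ S' u := fun hx u hu =>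
    (Finset.inf_le (f := id) (hmemF u hu) : F.inf id ≤ S' u) hx
  have hmemU : ∀ {x}, x ∈ F.sup id → ∃ u, G.Adj v u ∧ x ∈ S' u := fun {x} hx => by
    simpa [hF, Finset.mem_sup] using hx
  set A := (F.inf id).erase v with hA
  have hAmem : ∀ {x}, x ∈ A → ∀ u, G.Adj v u → x ∈ S u := by
    intro x hx u hu
    have hx' := Finset.mem_erase.1 hx
    have := hmemI hx'.2 u hu
    simp only [S', Finset.mem_insert, Finset.mem_erase] at this
    exact (this.resolve_left hx'.1).2
  have hAcard : (F.inf id).card ≤ A.card + 1 := by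
    have := Finset.pred_card_le_card_erase (s := F.inf id) (a := v)
    rw [hA]
    omega
  have hAind : G.IsIndepSet (A : Set V) := fun x hx y hy =>
    (hSmax u₀ hu₀).isIndepSet (hAmem hx u₀ hu₀) (hAmem hy u₀ hu₀)
  have hHallA := hHall A hAind
  have hd₁ : Disjoint (G.neighborFinset v) (A.biUnion (G.neighborFinset ·)) := by
    rw [Finset.disjoint_left]
    intro x hx hx'
    simp only [Finset.mem_biUnion, mem_neighborFinset] at hx hx'
    obtain ⟨y, hy, hyx⟩ := hx'
    exact (hSmax x hx).isIndepSet (hAmem hy x hx) (hSmem x hx) hyx.ne hyx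
  have hd₂ : Disjoint (G.neighborFinset v ∪ A.biUnion (G.neighborFinset ·)) (F.sup id) := by
    rw [Finset.disjoint_left]
    intro x hx hx'
    obtain ⟨u, hu, hxu⟩ := hmemU hx'
    simp only [Finset.mem_union, Finset.mem_biUnion, mem_neighborFinset] at hx
    rcases hx with hx | ⟨y, hy, hyx⟩
    · exact (hS'max u hu).isIndepSet (Finset.mem_insert_self _ _) hxu hx.ne hx
    · exact (hS'max u hu).isIndepSet (hmemI (Finset.mem_erase.1 hy).2 u hu) hxu hyx.ne hyx
  have hcard := Finset.card_le_univ
    ((G.neighborFinset v ∪ A.biUnion (G.neighborFinset ·)) ∪ F.sup id)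
  rw [Finset.card_union_of_disjoint hd₂, Finset.card_union_of_disjoint hd₁,
    card_neighborFinset_eq_degree] at hcard
  omega

end MaximumIndepSet

end SimpleGraph

section Transversal

variable {V : Type*} [Fintype V] {G : SimpleGraph V}

theorem exists_isTransversal_card_eq_tau (G : SimpleGraph V) :
    ∃ S : Finset V, IsTransversal G (S : Set V) ∧ S.card = tau G :=
  Nat.sInf_mem (s := {n | ∃ S : Finset V, IsTransversal G ↑S ∧ S.card = n})
    ⟨_, Finset.univ, by intro u v _; simp, rfl⟩

theorem IsTransversal.tau_le_card {S : Finset V} (h : IsTransversal G (S : Set V)) :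
    tau G ≤ S.card :=
  Nat.sInf_le ⟨S, h, rfl⟩

variable [DecidableEq V]

theorem isTransversal_compl_iff (S : Finset V) :
    IsTransversal G ((Sᶜ : Finset V) : Set V) ↔ G.IsIndepSet (S : Set V) := by
  constructor
  · intro h x hx y hy _ hadj
    have := h hadj
    simp_all
  · intro h x y hadj
    by_contra! hc
    simp only [Finset.coe_compl, Set.mem_compl_iff, Finset.mem_coe, not_not] at hc
    exact h hc.1 hc.2 hadj.ne hadj

theorem tau_add_indepNum (G : SimpleGraph V) : tau G + G.indepNum = Fintype.card V := by
  obtain ⟨T, hT, hTcard⟩ := exists_isTransversal_card_eq_tau G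
  obtain ⟨S, hS⟩ := G.exists_isNIndepSet_indepNum
  have h₁ := ((isTransversal_compl_iff S).2 hS.isIndepSet).tau_le_card
  have h₂ : Tᶜ.card ≤ G.indepNum :=
    IsIndepSet.card_le_indepNum ((isTransversal_compl_iff Tᶜ).1 (by simpa using hT))
  have h₃ := Finset.card_add_card_compl S
  have h₄ := Finset.card_add_card_compl T
  have := hS.card_eq
  omega

/-- In a τ-critical graph every edge `vu` admits a maximum independent set that contains `u` and no
other neighbour of `v`. -/
theorem TauCritical.exists_isMaximumIndepSet (h : TauCritical G) {v u : V} (hvu : G.Adj v u) :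
    ∃ S : Finset V, G.IsMaximumIndepSet S ∧ u ∈ S ∧ ∀ w ∈ S, G.Adj v w → w = u := by
  obtain ⟨T, hT, hTcard⟩ := exists_isTransversal_card_eq_tau (G.deleteEdges {s(v, u)})
  rw [h.2 _ hvu] at hTcard
  have hcover : ∀ x y, G.Adj x y → s(x, y) ≠ s(v, u) → x ∈ T ∨ y ∈ T := fun x y hxy hne => by
    simpa using hT (deleteEdges_adj.2 ⟨hxy, by simpa using hne⟩)
  have hinsert : ∀ z, (z = v ∨ z = u) → IsTransversal G ((insert z T : Finset V) : Set V) := by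
    intro z hz x y hxy
    by_cases hne : s(x, y) = s(v, u)
    · rcases Sym2.eq_iff.1 hne with ⟨rfl, rfl⟩ | ⟨rfl, rfl⟩ <;> rcases hz with rfl | rfl <;> simp
    · rcases hcover x y hxy hne with h | h <;> simp [h]
  have hpos : 0 < tau G := by
    obtain ⟨R, hR, hRcard⟩ := exists_isTransversal_card_eq_tau G
    rw [← hRcard, Finset.card_pos]
    rcases hR hvu with h | h
    exacts [⟨v, h⟩, ⟨u, h⟩]
  have hnotMem : ∀ z, (z = v ∨ z = u) → z ∉ T := by
    intro z hz hzT
    have := (hinsert z hz).tau_le_card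
    rw [Finset.insert_eq_of_mem hzT] at this
    omega
  have hv := hnotMem v (.inl rfl)
  have hu := hnotMem u (.inr rfl)
  refine ⟨(insert v T)ᶜ, ⟨?_, fun R hR => ?_⟩, by simp [hu, hvu.ne'], fun w hw hvw => ?_⟩
  · exact (isTransversal_compl_iff _).1 (by rw [compl_compl]; exact hinsert v (.inl rfl))
  · have h₁ := IsIndepSet.card_le_indepNum hR
    have h₂ := tau_add_indepNum G
    rw [Finset.card_compl, Finset.card_insert_of_notMem hv]
    omega
  · by_contra hne
    have := hcover v w hvw (by simpa using ⟨hne, fun h => absurd h hvu.ne⟩)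
    simp_all

end Transversal

section IndepNumTwo

/-- A duplicate-free enumeration of the vertices that respects adjacency is an isomorphism; both
conditions need to be checked for increasing pairs of indices only. -/
theorem SimpleGraph.nonempty_iso_of_forall_lt {V : Type*} {G : SimpleGraph V} {n : ℕ}
    {H : SimpleGraph (Fin n)} (f : Fin n → V) (hsurj : Function.Surjective f)
    (hne : ∀ i j, i < j → f i ≠ f j)
    (hadj : ∀ i j, i < j → (G.Adj (f i) (f j) ↔ H.Adj i j)) : Nonempty (G ≃g H) := by
  have hinj : Function.Injective f := fun i j hij => by
    by_contra hc
    rcases lt_or_gt_of_ne hc with h | h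
    exacts [hne i j h hij, hne j i h hij.symm]
  refine ⟨Iso.symm ⟨Equiv.ofBijective f ⟨hinj, hsurj⟩, fun {i j} => ?_⟩⟩
  rcases lt_trichotomy i j with h | rfl | h
  · exact hadj i j h
  · simp
  · rw [G.adj_comm, H.adj_comm]
    exact hadj j i h

variable {V : Type*} [Fintype V] [DecidableEq V] {G : SimpleGraph V} [DecidableRel G.Adj]

/-- A τ-critical graph with independence number two whose complement is 2-regular is `2K₂` or `C₅`:
the complement is a triangle-free 2-regular graph of diameter two. -/
theorem TauCritical.iso_twoK2_or_cycleGraph_five (h : TauCritical G) [Nonempty V]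
    (hα : G.indepNum = 2) (hdeg : ∀ v, Gᶜ.degree v = 2) :
    Nonempty (G ≃g twoK2) ∨ Nonempty (G ≃g cycleGraph 5) := by
  have hnbr : ∀ v x, Gᶜ.Adj v x → ∃ y, y ≠ x ∧ Gᶜ.Adj v y ∧ ∀ z, Gᶜ.Adj v z → z = x ∨ z = y := by
    intro v x hvx
    obtain ⟨p, q, hpq, hN⟩ := Finset.card_eq_two.1 (hdeg v)
    have hN' : ∀ z, Gᶜ.Adj v z ↔ z = p ∨ z = q := fun z => by
      rw [← mem_neighborFinset, hN]; simp
    rcases (hN' x).1 hvx with rfl | rfl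
    · exact ⟨q, hpq.symm, (hN' q).2 (.inr rfl), fun z hz => (hN' z).1 hz⟩
    · exact ⟨p, hpq, (hN' p).2 (.inl rfl), fun z hz => ((hN' z).1 hz).symm⟩
  have htri : ∀ x y z, Gᶜ.Adj x y → Gᶜ.Adj x z → Gᶜ.Adj y z → False := by
    intro x y z hxy hxz hyz
    have h3 := is3Clique_triple_iff.2 ⟨hxy, hxz, hyz⟩
    have hle := IsIndepSet.card_le_indepNum ((isClique_compl G).1 h3.isClique)
    rw [hα, h3.card_eq] at hle
    omega
  have hcommon : ∀ v u, G.Adj v u → ∃ w, Gᶜ.Adj v w ∧ Gᶜ.Adj u w := by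
    intro v u hvu
    obtain ⟨S, hS, huS, hSadj⟩ := h.exists_isMaximumIndepSet hvu
    have hcard := maximumIndepSet_card_eq_indepNum S hS
    obtain ⟨w, hw, hwu⟩ := Finset.exists_mem_ne (by omega : 1 < S.card) u
    refine ⟨w, (compl_adj ..).2 ⟨?_, fun hvw => hwu (hSadj w hw hvw)⟩,
      (compl_adj ..).2 ⟨hwu.symm, hS.isIndepSet huS hw hwu.symm⟩⟩
    rintro rfl
    exact hS.isIndepSet huS hw hwu.symm hvu.symm
  obtain ⟨v⟩ := ‹Nonempty V›
  obtain ⟨a, ha⟩ : ∃ a, Gᶜ.Adj v a := (Gᶜ.degree_pos_iff_exists_adj v).1 (by rw [hdeg]; omega)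
  obtain ⟨b, hba, hb, hv⟩ := hnbr v a ha
  obtain ⟨c, hcv, hc, ha'⟩ := hnbr a v ha.symm
  obtain ⟨d, hdv, hd, hb'⟩ := hnbr b v hb.symm
  have hall : ∀ x, x = v ∨ x = a ∨ x = b ∨ x = c ∨ x = d := by
    intro x
    by_cases hx : G.Adj v x
    · obtain ⟨w, hvw, hxw⟩ := hcommon v x hx
      rcases hv w hvw with rfl | rfl
      · rcases ha' x hxw.symm with h | h <;> simp [h]
      · rcases hb' x hxw.symm with h | h <;> simp [h]
    · by_cases hxv : v = x
      · simp [hxv]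
      · rcases hv x ((compl_adj ..).2 ⟨hxv, hx⟩) with h | h <;> simp [h]
  have hadj : ∀ {x y}, x ≠ y → ¬ Gᶜ.Adj x y → G.Adj x y := fun hne hnot => by
    by_contra hc
    exact hnot ((compl_adj ..).2 ⟨hne, hc⟩)
  have hab : G.Adj a b := hadj hba.symm fun hab => htri v a b ha hb hab
  have hcb : c ≠ b := by
    rintro rfl
    exact hc.2 hab
  have hda : d ≠ a := by
    rintro rfl
    exact hd.2 hab.symm
  have hvc : G.Adj v c := hadj hcv.symm fun hvc => by
    rcases hv c hvc with rfl | rfl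
    exacts [hc.ne rfl, hcb rfl]
  have hca := hc.symm.2
  have hdb := hd.symm.2
  by_cases hcd : c = d
  · subst hcd
    refine .inl (nonempty_iso_of_forall_lt ![v, c, a, b] (fun x => ?_) ?_ ?_)
    · rcases hall x with rfl | rfl | rfl | rfl | rfl
      exacts [⟨0, rfl⟩, ⟨2, rfl⟩, ⟨3, rfl⟩, ⟨1, rfl⟩, ⟨1, rfl⟩]
    · simp [Fin.forall_fin_succ, ha.ne, hb.ne, hc.ne', hcv.symm, hcb, hba.symm]
    · simp [Fin.forall_fin_succ, twoK2, ha.2, hb.2, hca, hdb, hvc, hab]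
  · have hcb' : G.Adj c b := hadj hcb fun hcb' => by
      rcases hb' c hcb'.symm with rfl | rfl
      exacts [hcv rfl, hcd rfl]
    have had : G.Adj a d := hadj hda.symm fun had => by
      rcases ha' d had with rfl | rfl
      exacts [hdv rfl, hcd rfl]
    have hvd : G.Adj v d := hadj hdv.symm fun hvd => by
      rcases hv d hvd with rfl | rfl
      exacts [hda rfl, hd.ne rfl]
    have hcd' : ¬ G.Adj c d := by
      obtain ⟨y, hya, hcy, -⟩ := hnbr c a hc.symm
      rcases hall y with rfl | rfl | rfl | rfl | rfl
      exacts [(hcy.2 hvc.symm).elim, (hya rfl).elim, (hcy.2 hcb').elim, (hcy.ne rfl).elim, hcy.2]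
    refine .inr (nonempty_iso_of_forall_lt ![v, c, b, a, d] (fun x => ?_) ?_ ?_)
    · rcases hall x with rfl | rfl | rfl | rfl | rfl
      exacts [⟨0, rfl⟩, ⟨3, rfl⟩, ⟨2, rfl⟩, ⟨1, rfl⟩, ⟨4, rfl⟩]
    · simp [Fin.forall_fin_succ, ha.ne, hb.ne, hc.ne', hd.ne, hcv.symm, hdv.symm, hcb, hcd, hba,
        hda.symm]
    · simp [Fin.forall_fin_succ, cycleGraph_adj, ha.2, hb.2, hca, hd.2, hvc, hvd, hab.symm, had,
        hcb', hcd']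
      decide

end IndepNumTwo

theorem extremal_classification {V : Type*} [Fintype V] [DecidableEq V]
    (G : SimpleGraph V) [DecidableRel G.Adj] (t : ℕ)
    (hcrit : TauCritical G) (ht : tau G = t)
    (heq : Fintype.card V + G.edgeFinset.card = (t + 2).choose 2) :
    (∃ n : ℕ, 2 ≤ n ∧ Nonempty (G ≃g (⊤ : SimpleGraph (Fin n)))) ∨
      Nonempty (G ≃g twoK2) ∨ Nonempty (G ≃g cycleGraph 5) := by
  have hdeg := degree_add_two_mul_indepNum_le hcrit.1
    fun v u hvu => hcrit.exists_isMaximumIndepSet hvu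
  have hn := tau_add_indepNum G
  rw [ht] at hn
  have hsum := G.sum_degrees_eq_twice_card_edges
  have hchoose : (t + 2).choose 2 * 2 = (t + 2) * (t + 1) := by
    rw [Nat.choose_two_right, Nat.add_sub_assoc (by omega)]
    exact Nat.div_mul_cancel (Nat.even_mul_pred_self (t + 2)).two_dvd
  have hV : Nonempty V := by
    by_contra hV
    rw [not_nonempty_iff] at hV
    have : G.edgeFinset = ∅ := by
      ext e
      exact isEmptyElim e
    rw [this, Fintype.card_eq_zero] at heq
    have := Nat.choose_pos (show 2 ≤ t + 2 by omega)
    simp at heq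
    omega
  have hα : 1 ≤ G.indepNum := by
    obtain ⟨v⟩ := hV
    simpa using IsIndepSet.card_le_indepNum (G := G) (t := {v}) (by simp)
  set α := G.indepNum with hαdef
  set n := Fintype.card V with hndef
  have hgap : ∑ v, (n + 1 - 2 * α - G.degree v : ℤ) = - ((α - 1) * (α - 2) : ℤ) := by
    rw [Finset.sum_sub_distrib]
    have h₁ : (∑ v, (G.degree v : ℤ)) = 2 * G.edgeFinset.card := by exact_mod_cast hsum
    have h₂ : ((t : ℤ) + 2) * (t + 1) = (n + G.edgeFinset.card) * 2 := by
      exact_mod_cast (heq ▸ hchoose).symm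
    have h₃ : (n : ℤ) = t + α := by exact_mod_cast hn.symm
    rw [h₁, Finset.sum_const, Finset.card_univ, ← hndef, nsmul_eq_mul, h₃] at *
    linarith
  have hnonneg : ∀ v ∈ Finset.univ, (0 : ℤ) ≤ n + 1 - 2 * α - G.degree v := fun v _ => by
    have := hdeg v
    omega
  have hα2 : α = 1 ∨ α = 2 := by
    have := Finset.sum_nonneg hnonneg
    rw [hgap] at this
    by_contra! hne
    have : (3 : ℤ) ≤ α := by omega
    nlinarith
  have hdeg_eq : ∀ v, (G.degree v : ℤ) = n + 1 - 2 * α := fun v => by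
    have h0 : ∑ v, (n + 1 - 2 * α - G.degree v : ℤ) = 0 := by
      rw [hgap]
      rcases hα2 with h | h <;> simp [h]
    have := (Finset.sum_eq_zero_iff_of_nonneg hnonneg).1 h0 v (Finset.mem_univ v)
    omega
  rcases hα2 with hα1 | hα2
  · left
    have htop : G = ⊤ := by
      ext x y
      refine ⟨fun h => h.ne, fun hne => ?_⟩
      by_contra hxy
      have := IsIndepSet.card_le_indepNum (G := G) (t := {x, y}) (by
        simpa [IsIndepSet, Set.pairwise_pair, G.adj_comm y x] using fun _ => hxy)
      rw [Finset.card_pair hne] at this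
      omega
    refine ⟨n, ?_, ?_⟩
    · obtain ⟨v⟩ := hV
      obtain ⟨u, hu⟩ := hcrit.1 v
      exact Fintype.one_lt_card_iff.2 ⟨v, u, hu.ne⟩
    · subst htop
      exact ⟨Iso.completeGraph (Fintype.equivFin V)⟩
  · right
    refine hcrit.iso_twoK2_or_cycleGraph_five hα2 fun v => ?_
    have := hdeg_eq v
    rw [degree_compl]
    omega
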